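/- Double-resonance quintic counting estimate (Lemma 3.9): Let 1 < α ≤ 2, let ε > 0 be arbitrarily small, and fix signs ε_123, ε_1, ε_2, ε_3 ∈ {−1,+1}. There exists C = C(α, ε) > 0 (uniform in the sign choice) such that for all dyadic numbers N_1, N_2, N_3 ≥ 1, every ζ ∈ ℝ, and every n_1 ∈ ℤ³ with |n_1| ∼ N_1, Σ_{n_2, n_3 ∈ ℤ³} [ (Π_{j=2}^3 1_{|n_j| ∼ N_j}) · ⟪n_1+n_2+n_3⟫^{−1} · ⟪n_2⟫^{−2} · ⟪n_3⟫^{−2} · 1_{|κ_2(n_1,n_2,n_3) − ζ| ≤ 1} ] ≤ C · N_2^{2−2α+ε} · N_3^{2−2α+ε}. -/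

import Mathlib

noncomputable section

open scoped BigOperators

/-- Japanese bracket of a real number: `⟨x⟩ = (1 + x²)^{1/2}`. -/
def rjb (x : ℝ) : ℝ := Real.sqrt (1 + x ^ 2)

/-- Euclidean norm of a lattice point in `ℤ³`. -/
def znorm (n : Fin 3 → ℤ) : ℝ := Real.sqrt (∑ i, ((n i : ℝ)) ^ 2)

/-- Japanese bracket `⟨n⟩ = (1 + |n|²)^{1/2}` of a lattice point in `ℤ³`. -/
def jb (n : Fin 3 → ℤ) : ℝ := Real.sqrt (1 + ∑ i, ((n i : ℝ)) ^ 2)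

/-- The modified bracket `⟪n⟫ = (⟨n⟩^{2α} − 1/4)^{1/2}`. -/
def jbb (α : ℝ) (n : Fin 3 → ℤ) : ℝ := Real.sqrt (jb n ^ (2 * α) - 1 / 4)

/-- Dyadic numbers `2^j`, `j ≥ 0`. -/
def IsDyadic (N : ℝ) : Prop := ∃ j : ℕ, N = 2 ^ j

/-- `|n| ∼ N` for a dyadic number `N`: `N/2 < |n| ≤ N` if `N ≥ 2`, and `|n| ≤ 1` if `N = 1`. -/
def SimFreq (N : ℝ) (n : Fin 3 → ℤ) : Prop :=
  (2 ≤ N ∧ N / 2 < znorm n ∧ znorm n ≤ N) ∨ (N < 2 ∧ znorm n ≤ 1)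

/-- `x` is a sign `±1`. -/
def IsSign (x : ℝ) : Prop := x = 1 ∨ x = -1

open Classical in
/-- Real-valued indicator of a proposition. -/
def ind (p : Prop) : ℝ := if p then 1 else 0

/-- If the sublevel sets `{ρ ≤ 2 ^ i}` of `E` have at most `K (2 ^ i) ^ (e + 1)` points, then the
sum of `1 / ρ` over `E` is of the size it has when `ρ` is comparable to `2 ^ j` throughout. -/
lemma sum_inv_le_of_card_le {ι : Type*} (E : Finset ι) (ρ : ι → ℝ) (K : ℝ) (e j : ℕ)
    (he : 1 ≤ e) (hρ : ∀ x ∈ E, 1 ≤ ρ x)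
    (hball : ∀ i : ℕ, ((E.filter (fun x => ρ x ≤ 2 ^ i)).card : ℝ) ≤ K * (2 ^ i) ^ (e + 1))
    (hE : (E.card : ℝ) ≤ K * (2 ^ j) ^ (e + 1)) :
    ∑ x ∈ E, (ρ x)⁻¹ ≤ 5 * K * (2 ^ j) ^ e := by
  have hK : 0 ≤ K := by
    have := (Nat.cast_nonneg _).trans (hball 0)
    simpa using this
  have hfar : ∀ (i : ℕ) (S : Finset ι) (c : ℝ), (∀ x ∈ S, (2 : ℝ) ^ i ≤ ρ x) →
      (S.card : ℝ) ≤ c → ∑ x ∈ S, (ρ x)⁻¹ ≤ c * (2 ^ i)⁻¹ := by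
    intro i S c hS hc
    calc ∑ x ∈ S, (ρ x)⁻¹ ≤ ∑ _x ∈ S, ((2 : ℝ) ^ i)⁻¹ :=
          Finset.sum_le_sum fun x hx => inv_anti₀ (by positivity) (hS x hx)
      _ = S.card * (2 ^ i)⁻¹ := by rw [Finset.sum_const, nsmul_eq_mul]
      _ ≤ _ := by gcongr
  have hnear : ∀ i : ℕ,
      ∑ x ∈ E.filter (fun x => ρ x ≤ 2 ^ i), (ρ x)⁻¹ ≤ 4 * K * (2 ^ i) ^ e := by
    intro i
    induction i with
    | zero =>
      have h := hfar 0 (E.filter (fun x => ρ x ≤ 2 ^ 0)) _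
        (fun x hx => by simpa using hρ x (Finset.mem_filter.1 hx).1) (hball 0)
      simp only [pow_zero, one_pow, mul_one, inv_one] at h ⊢
      linarith
    | succ i ih =>
      rw [← Finset.sum_filter_add_sum_filter_not _ (fun x => ρ x ≤ 2 ^ i)]
      have h1 : ∑ x ∈ (E.filter (fun x => ρ x ≤ 2 ^ (i + 1))).filter (fun x => ρ x ≤ 2 ^ i),
          (ρ x)⁻¹ ≤ 4 * K * (2 ^ i) ^ e := by
        refine le_trans (Finset.sum_le_sum_of_subset_of_nonneg ?_ ?_) ih
        · intro x hx
          simp only [Finset.mem_filter] at hx ⊢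
          exact ⟨hx.1.1, hx.2⟩
        · intro x hx _
          have := hρ x (Finset.mem_filter.1 hx).1
          positivity
      have h2 := hfar i ((E.filter (fun x => ρ x ≤ 2 ^ (i + 1))).filter
          (fun x => ¬ ρ x ≤ 2 ^ i)) (K * (2 ^ (i + 1)) ^ (e + 1))
        (fun x hx => (not_le.1 (Finset.mem_filter.1 hx).2).le)
        (le_trans (Nat.cast_le.2 (Finset.card_le_card (Finset.filter_subset _ _)))
          (hball (i + 1)))
      have h3 : K * ((2 : ℝ) ^ (i + 1)) ^ (e + 1) * (2 ^ i)⁻¹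
          = 2 * K * 2 ^ e * (2 ^ i) ^ e := by
        rw [pow_succ 2 i, mul_pow, pow_succ _ e, pow_succ _ e]
        field_simp
      have h4 : ((2 : ℝ) ^ (i + 1)) ^ e = 2 ^ e * (2 ^ i) ^ e := by
        rw [pow_succ, mul_pow, mul_comm]
      have h5 : (2 : ℝ) ≤ 2 ^ e := by
        simpa using pow_le_pow_right₀ (one_le_two (α := ℝ)) he
      rw [h3] at h2
      rw [h4]
      have h6 : 0 ≤ K * (2 ^ i) ^ e := by positivity
      nlinarith [mul_le_mul_of_nonneg_right h5 h6]
  rw [← Finset.sum_filter_add_sum_filter_not _ (fun x => ρ x ≤ 2 ^ j)]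
  have h2 := hfar j (E.filter (fun x => ¬ ρ x ≤ 2 ^ j)) (K * (2 ^ j) ^ (e + 1))
    (fun x hx => (not_le.1 (Finset.mem_filter.1 hx).2).le)
    (le_trans (Nat.cast_le.2 (Finset.card_le_card (Finset.filter_subset _ _))) hE)
  have h3 : K * ((2 : ℝ) ^ j) ^ (e + 1) * (2 ^ j)⁻¹ = K * (2 ^ j) ^ e := by
    rw [pow_succ _ e]
    field_simp
  linarith [hnear j]

/-- A finite set of integers of diameter at most `D` has at most `D + 1` elements. -/
lemma card_le_of_sub_le (S : Finset ℤ) (D : ℝ) (hD : 0 ≤ D)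
    (h : ∀ s ∈ S, ∀ t ∈ S, s < t → ((t : ℝ) - s) ≤ D) : (S.card : ℝ) ≤ D + 1 := by
  rcases S.eq_empty_or_nonempty with rfl | hS
  · simp; linarith
  have hsub : S ⊆ Finset.Icc (S.min' hS) (S.min' hS + ⌊D⌋) := by
    intro t ht
    have hmt := S.min'_le t ht
    refine Finset.mem_Icc.2 ⟨hmt, ?_⟩
    have hDf : 0 ≤ ⌊D⌋ := Int.floor_nonneg.2 hD
    rcases hmt.lt_or_eq with hlt | heq
    · have : t - S.min' hS ≤ ⌊D⌋ := by
        rw [Int.le_floor]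
        push_cast
        exact h _ (S.min'_mem hS) t ht hlt
      omega
    · omega
  have hc := Finset.card_le_card hsub
  rw [Int.card_Icc] at hc
  have hc' : (S.card : ℤ) ≤ ⌊D⌋ + 1 := by
    have hDf : 0 ≤ ⌊D⌋ := Int.floor_nonneg.2 hD
    omega
  calc (S.card : ℝ) = ((S.card : ℤ) : ℝ) := by simp
    _ ≤ ((⌊D⌋ + 1 : ℤ) : ℝ) := by exact_mod_cast hc'
    _ ≤ D + 1 := by push_cast; linarith [Int.floor_le D]

lemma jb_sq (n : Fin 3 → ℤ) : jb n ^ 2 = 1 + ∑ i, (n i : ℝ) ^ 2 :=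
  Real.sq_sqrt (by positivity)

lemma one_le_jb (n : Fin 3 → ℤ) : 1 ≤ jb n := by
  rw [jb, Real.one_le_sqrt]
  have : 0 ≤ ∑ i, (n i : ℝ) ^ 2 := by positivity
  linarith

lemma jb_pos (n : Fin 3 → ℤ) : 0 < jb n := zero_lt_one.trans_le (one_le_jb n)

lemma jb_neg (n : Fin 3 → ℤ) : jb (-n) = jb n := by
  simp [jb]

lemma abs_le_jb (n : Fin 3 → ℤ) (i : Fin 3) : |(n i : ℝ)| ≤ jb n := by
  refine abs_le_of_sq_le_sq ?_ (jb_pos n).le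
  rw [jb_sq]
  have := Finset.single_le_sum (f := fun i => (n i : ℝ) ^ 2) (fun i _ => sq_nonneg _)
    (Finset.mem_univ i)
  linarith

/-- Cauchy–Schwarz for the vectors `(1, x)` and `(1, y)`. -/
lemma one_add_sum_mul_le (x y : Fin 3 → ℤ) :
    1 + ∑ i, (x i : ℝ) * y i ≤ jb x * jb y := by
  refine le_of_sq_le_sq ?_ (mul_pos (jb_pos x) (jb_pos y)).le
  rw [mul_pow, jb_sq, jb_sq]
  simp only [Fin.sum_univ_three]
  nlinarith [sq_nonneg ((x 0 : ℝ) - y 0), sq_nonneg ((x 1 : ℝ) - y 1),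
    sq_nonneg ((x 2 : ℝ) - y 2), sq_nonneg ((x 0 : ℝ) * y 1 - x 1 * y 0),
    sq_nonneg ((x 0 : ℝ) * y 2 - x 2 * y 0), sq_nonneg ((x 1 : ℝ) * y 2 - x 2 * y 1)]

/-- The `i`-th component of the gradient of `⟨·⟩ ^ α`. -/
def jbGrad (α : ℝ) (n : Fin 3 → ℤ) (i : Fin 3) : ℝ := α * jb n ^ (α - 2) * n i

lemma jbGrad_neg (α : ℝ) (n : Fin 3 → ℤ) (i : Fin 3) :
    jbGrad α (-n) i = -jbGrad α n i := by
  simp [jbGrad, jb_neg]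

lemma rpow_tangent_le {α X Y : ℝ} (hα : 1 ≤ α) (hX : 0 < X) (hY : 0 < Y) :
    X ^ α + α * X ^ (α - 1) * (Y - X) ≤ Y ^ α := by
  have h := one_add_mul_self_le_rpow_one_add (s := Y / X - 1) (p := α)
    (by have := div_pos hY hX; linarith) hα
  rw [show 1 + (Y / X - 1) = Y / X by ring, Real.div_rpow hY.le hX.le,
    le_div_iff₀ (by positivity)] at h
  rw [Real.rpow_sub_one hX.ne']
  refine le_trans (le_of_eq ?_) h
  field_simp

lemma rpow_le_tangent {β X Y : ℝ} (hβ : 0 ≤ β) (hβ' : β ≤ 1) (hX : 0 < X) (hY : 0 < Y) :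
    Y ^ β ≤ X ^ β + β * X ^ (β - 1) * (Y - X) := by
  have h := rpow_one_add_le_one_add_mul_self (s := Y / X - 1) (p := β)
    (by have := div_pos hY hX; linarith) hβ hβ'
  rw [show 1 + (Y / X - 1) = Y / X by ring, Real.div_rpow hY.le hX.le,
    div_le_iff₀ (by positivity)] at h
  rw [Real.rpow_sub_one hX.ne']
  refine h.trans (le_of_eq ?_)
  field_simp

/-- Convexity of `⟨·⟩ ^ α` in the form of the tangent inequality. -/
lemma jb_rpow_tangent_le {α : ℝ} (hα : 1 ≤ α) (x y : Fin 3 → ℤ) :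
    jb x ^ α + ∑ i, jbGrad α x i * ((y i : ℝ) - x i) ≤ jb y ^ α := by
  have hX := jb_pos x
  have hY := jb_pos y
  refine le_trans ?_ (rpow_tangent_le hα hX hY)
  have h1 : ∑ i, jbGrad α x i * ((y i : ℝ) - x i)
      = α * jb x ^ (α - 2) * ((1 + ∑ i, (x i : ℝ) * y i) - jb x ^ 2) := by
    rw [jb_sq]
    simp only [jbGrad, Fin.sum_univ_three]
    ring
  have h2 : jb x ^ (α - 1) = jb x ^ (α - 2) * jb x := by
    rw [← Real.rpow_add_one hX.ne']
    congr 1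
    ring
  rw [h1, h2]
  have h3 : 0 ≤ α * jb x ^ (α - 2) := by positivity
  nlinarith [mul_le_mul_of_nonneg_left (one_add_sum_mul_le x y) h3]

/-- Quantitative strict monotonicity of the gradient of `⟨·⟩ ^ α`. -/
lemma le_sum_jbGrad_sub {α : ℝ} (hα₁ : 1 < α) (hα₂ : α ≤ 2) (x y : Fin 3 → ℤ) :
    α * (α - 1) * (jb x + jb y)⁻¹ * ∑ i, ((x i : ℝ) - y i) ^ 2
      ≤ ∑ i, (jbGrad α x i - jbGrad α y i) * ((x i : ℝ) - y i) := by
  wlog hxy : jb y ≤ jb x generalizing x y with H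
  · have h := H y x (le_of_not_ge hxy)
    rw [add_comm (jb x)]
    convert h using 2 with i
    · exact Finset.sum_congr rfl fun i _ => by ring
    · ring
  have hX := jb_pos x
  have hY := jb_pos y
  have hX1 := one_le_jb x
  set X := jb x with hXdef
  set Y := jb y with hYdef
  set p := X ^ (α - 2) with hp
  set q := Y ^ (α - 2) with hq
  set τ := X * Y - (1 + ∑ i, (x i : ℝ) * y i) with hτ
  have hτ0 : 0 ≤ τ := sub_nonneg.2 (one_add_sum_mul_le x y)
  have hp0 : 0 < p := by positivity
  have hpq : p ≤ q := Real.rpow_le_rpow_of_nonpos hY hxy (by linarith)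
  have hpX : X ^ (α - 1) = p * X := by
    rw [hp, ← Real.rpow_add_one hX.ne']; congr 1; ring
  have hqY : Y ^ (α - 1) = q * Y := by
    rw [hq, ← Real.rpow_add_one hY.ne']; congr 1; ring
  have hconc : q * Y ≤ p * X + (α - 1) * p * (Y - X) := by
    have h := rpow_le_tangent (β := α - 1) (by linarith) (by linarith) hX hY
    rwa [hpX, hqY, show α - 1 - 1 = α - 2 by ring, ← hp] at h
  have hD : ∑ i, ((x i : ℝ) - y i) ^ 2 = (X - Y) ^ 2 + 2 * τ := by
    have h1 := jb_sq x
    have h2 := jb_sq y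
    rw [← hXdef] at h1
    rw [← hYdef] at h2
    simp only [hτ, Fin.sum_univ_three] at h1 h2 ⊢
    linear_combination -h1 - h2
  have hE : ∑ i, (jbGrad α x i - jbGrad α y i) * ((x i : ℝ) - y i)
      = α * ((p * X - q * Y) * (X - Y) + (p + q) * τ) := by
    have h1 := jb_sq x
    have h2 := jb_sq y
    rw [← hXdef] at h1
    rw [← hYdef] at h2
    simp only [hτ, jbGrad, ← hXdef, ← hYdef, ← hp, ← hq, Fin.sum_univ_three] at h1 h2 ⊢
    linear_combination -α * p * h1 - α * q * h2
  have hpinv : (X + Y)⁻¹ ≤ p := by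
    calc (X + Y)⁻¹ ≤ X⁻¹ := inv_anti₀ hX (by linarith)
      _ = X ^ (-1 : ℝ) := (Real.rpow_neg_one X).symm
      _ ≤ p := Real.rpow_le_rpow_of_exponent_le hX1 (by linarith)
  rw [hD, hE]
  have h1 : 0 ≤ (X - Y) ^ 2 + 2 * τ := by positivity
  have h2 : (α - 1) * p * ((X - Y) ^ 2 + 2 * τ)
      ≤ (p * X - q * Y) * (X - Y) + (p + q) * τ := by
    have h3 : (α - 1) * p * (X - Y) * (X - Y) ≤ (p * X - q * Y) * (X - Y) :=
      mul_le_mul_of_nonneg_right (by linarith) (by linarith)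
    have h4 : (α - 1) * (2 * p) * τ ≤ (p + q) * τ :=
      mul_le_mul_of_nonneg_right (by nlinarith) hτ0
    linarith
  calc α * (α - 1) * (X + Y)⁻¹ * ((X - Y) ^ 2 + 2 * τ)
      ≤ α * (α - 1) * p * ((X - Y) ^ 2 + 2 * τ) := by
        have : 0 ≤ α * (α - 1) := mul_nonneg (by linarith) (by linarith)
        gcongr
    _ = α * ((α - 1) * p * ((X - Y) ^ 2 + 2 * τ)) := by ring
    _ ≤ _ := mul_le_mul_of_nonneg_left h2 (by linarith)

/-- The lattice cube `{n : |n i| ≤ N}`. -/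
def latticeBox (N : ℕ) : Finset (Fin 3 → ℤ) :=
  Fintype.piFinset fun _ => Finset.Icc (-(N : ℤ)) N

lemma mem_latticeBox {N : ℕ} {n : Fin 3 → ℤ} : n ∈ latticeBox N ↔ ∀ i, |n i| ≤ N := by
  simp [latticeBox, abs_le]

lemma mem_latticeBox_iff_norm_le {N : ℕ} {n : Fin 3 → ℤ} :
    n ∈ latticeBox N ↔ ‖n‖ ≤ N := by
  rw [mem_latticeBox, pi_norm_le_iff_of_nonneg (Nat.cast_nonneg N)]
  refine forall_congr' fun i => ?_
  rw [Int.norm_eq_abs]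
  exact_mod_cast Iff.rfl

lemma card_latticeBox_le {N : ℕ} (hN : 1 ≤ N) :
    ((latticeBox N).card : ℝ) ≤ 27 * (N : ℝ) ^ 3 := by
  have h1 : (latticeBox N).card = (2 * N + 1) ^ 3 := by
    rw [latticeBox, Fintype.card_piFinset_const, Int.card_Icc]
    congr 1
    omega
  have h2 : (2 * N + 1) ^ 3 ≤ (3 * N) ^ 3 := Nat.pow_le_pow_left (by omega) 3
  rw [h1]
  calc (((2 * N + 1) ^ 3 : ℕ) : ℝ) ≤ (((3 * N) ^ 3 : ℕ) : ℝ) := by exact_mod_cast h2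
    _ = 27 * (N : ℝ) ^ 3 := by push_cast; ring

/-- Lattice points of a coordinate plane near a given (half-integral) point. -/
lemma card_plane_le (i : Fin 3) (c : Fin 3 → ℤ) {A : ℕ} (hA : 1 ≤ A)
    (S : Finset (Fin 3 → ℤ)) (a : ℤ) (ha : a ≠ 0) (h0 : ∀ p ∈ S, p i = 0)
    (hS : ∀ p ∈ S, ∀ k, k ≠ i → |a * p k - c k| ≤ A) :
    (S.card : ℝ) ≤ 9 * (A : ℝ) ^ 2 := by
  have h1 : S.card ≤ (Fintype.piFinset fun k : Fin 3 =>
      if k = i then {0} else Finset.Icc (-(A : ℤ)) A).card := by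
    refine Finset.card_le_card_of_injOn
      (fun p k => if k = i then 0 else a * p k - c k) ?_ ?_
    · intro p hp
      simp only [Finset.mem_coe, Fintype.mem_piFinset]
      intro k
      by_cases hk : k = i
      · simp [hk]
      · simpa [hk] using abs_le.1 (hS p hp k hk)
    · intro p hp q hq hpq
      funext k
      by_cases hk : k = i
      · rw [hk, h0 p hp, h0 q hq]
      · have := congrFun hpq k
        simp only [hk, if_false] at this
        exact mul_left_cancel₀ ha (by linarith)
  have h2 : (Fintype.piFinset fun k : Fin 3 =>
      if k = i then {0} else Finset.Icc (-(A : ℤ)) A).card = (2 * A + 1) ^ 2 := by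
    rw [Fintype.card_piFinset, Fin.prod_univ_three]
    have h3 : (Finset.Icc (-(A : ℤ)) A).card = 2 * A + 1 := by
      rw [Int.card_Icc]; omega
    fin_cases i <;> simp [h3] <;> ring
  have h4 : S.card ≤ (3 * A) ^ 2 := by
    rw [h2] at h1
    exact h1.trans (Nat.pow_le_pow_left (by omega) 2)
  calc (S.card : ℝ) ≤ (((3 * A) ^ 2 : ℕ) : ℝ) := by exact_mod_cast h4
    _ = 9 * (A : ℝ) ^ 2 := by push_cast; ring

/-- The `i`-th partial derivative of `⟨·⟩ ^ α + ⟨· - c⟩ ^ α`. -/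
def pairGrad (α : ℝ) (c n : Fin 3 → ℤ) (i : Fin 3) : ℝ := jbGrad α n i + jbGrad α (n - c) i

/-- The tangent inequality for `⟨·⟩ ^ α + ⟨· - c⟩ ^ α` along a coordinate line. -/
lemma pair_tangent_le {α : ℝ} (hα : 1 ≤ α) (c : Fin 3 → ℤ) (i : Fin 3) {n m : Fin 3 → ℤ}
    (h : ∀ k, k ≠ i → m k = n k) :
    jb n ^ α + jb (n - c) ^ α + pairGrad α c n i * ((m i : ℝ) - n i)
      ≤ jb m ^ α + jb (m - c) ^ α := by
  have h1 := jb_rpow_tangent_le hα n m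
  have h2 := jb_rpow_tangent_le hα (n - c) (m - c)
  rw [Finset.sum_eq_single i (fun k _ hk => by rw [h k hk, sub_self, mul_zero])
    (by simp)] at h1
  rw [Finset.sum_eq_single i (fun k _ hk => by
    rw [Pi.sub_apply, Pi.sub_apply, h k hk, sub_self, mul_zero]) (by simp)] at h2
  rw [pairGrad]
  simp only [Pi.sub_apply, Int.cast_sub] at h2
  linarith

lemma jb_le_of_norm_le {n : Fin 3 → ℤ} {R : ℝ} (hR : 1 ≤ R) (h : ‖n‖ ≤ R) : jb n ≤ 2 * R := by
  refine le_of_sq_le_sq ?_ (by linarith)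
  have hk : ∀ k, (n k : ℝ) ^ 2 ≤ R ^ 2 := fun k => by
    have := (norm_le_pi_norm n k).trans h
    rw [Int.norm_eq_abs] at this
    exact sq_le_sq' (abs_le.1 this).1 (abs_le.1 this).2
  rw [jb_sq, Fin.sum_univ_three]
  nlinarith [hk 0, hk 1, hk 2]

/-- Away from the critical point `c / 2`, some partial derivative of `⟨·⟩ ^ α + ⟨· - c⟩ ^ α`
is bounded below. -/
lemma exists_le_abs_pairGrad {α : ℝ} (hα₁ : 1 < α) (hα₂ : α ≤ 2) (c : Fin 3 → ℤ) {N : ℕ}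
    (hN : 1 ≤ N) {n : Fin 3 → ℤ} (hn : n ∈ latticeBox N) :
    ∃ i, α * (α - 1) * ‖n + n - c‖ / (12 * (N + ‖n + n - c‖)) ≤ |pairGrad α c n i| := by
  by_contra! hlt
  set u := n + n - c with hu
  set r := ‖u‖ with hr
  set b := α * (α - 1) with hb
  have hb0 : 0 < b := mul_pos (by linarith) (by linarith)
  have hN' : (1 : ℝ) ≤ N := by exact_mod_cast hN
  have hr0 : 0 ≤ r := norm_nonneg u
  have hrpos : 0 < r := by
    rcases hr0.lt_or_eq with h | h
    · exact h
    · have := hlt 0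
      rw [← h] at this
      simp at this
      exact absurd this (not_lt.2 (abs_nonneg _))
  have hmono := le_sum_jbGrad_sub hα₁ hα₂ n (c - n)
  have hD : ∀ i, jbGrad α n i - jbGrad α (c - n) i = pairGrad α c n i := fun i => by
    rw [pairGrad, ← neg_sub n c, jbGrad_neg, sub_neg_eq_add]
  have hui : ∀ i, (n i : ℝ) - ((c - n) i : ℤ) = u i := fun i => by
    simp only [hu, Pi.sub_apply, Pi.add_apply]; push_cast; ring
  simp only [hD, hui] at hmono
  have hnN : ‖n‖ ≤ N := mem_latticeBox_iff_norm_le.1 hn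
  have hX : jb n ≤ 2 * N := jb_le_of_norm_le hN' hnN
  have hY : jb (c - n) ≤ 2 * (N + r) := by
    refine jb_le_of_norm_le (by linarith) ?_
    have : c - n = n - u := by rw [hu]; abel
    rw [this]
    exact (norm_sub_le _ _).trans (by linarith)
  have hXY : (4 * (N + r))⁻¹ ≤ (jb n + jb (c - n))⁻¹ :=
    inv_anti₀ (add_pos (jb_pos _) (jb_pos _)) (by linarith)
  obtain ⟨k, hk⟩ : ∃ k, r ≤ |(u k : ℝ)| := by
    by_contra! hall
    have : ‖u‖ < r := (pi_norm_lt_iff hrpos).2 fun k => by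
      rw [Int.norm_eq_abs]; exact hall k
    exact lt_irrefl _ this
  have hsq : r ^ 2 ≤ ∑ i, (u i : ℝ) ^ 2 := by
    have h1 := Finset.single_le_sum (f := fun i => (u i : ℝ) ^ 2) (fun i _ => sq_nonneg _)
      (Finset.mem_univ k)
    refine le_trans ?_ h1
    rw [← sq_abs (u k : ℝ)]
    exact pow_le_pow_left₀ hr0 hk 2
  have hlow : b * (4 * (N + r))⁻¹ * r ^ 2 ≤ ∑ i, pairGrad α c n i * (u i : ℝ) := by
    refine le_trans ?_ hmono
    have : 0 ≤ b * (jb n + jb (c - n))⁻¹ :=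
      mul_nonneg hb0.le (inv_nonneg.2 (add_pos (jb_pos _) (jb_pos _)).le)
    gcongr
  have hup : ∑ i, pairGrad α c n i * (u i : ℝ) < ∑ _i : Fin 3, b * r / (12 * (N + r)) * r := by
    refine Finset.sum_lt_sum_of_nonempty Finset.univ_nonempty fun i _ => ?_
    have h1 : |(u i : ℝ)| ≤ r := by
      have := norm_le_pi_norm u i
      rwa [Int.norm_eq_abs] at this
    calc pairGrad α c n i * (u i : ℝ) ≤ |pairGrad α c n i| * |(u i : ℝ)| := by
          rw [← abs_mul]; exact le_abs_self _
      _ ≤ |pairGrad α c n i| * r := by gcongr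
      _ < _ := mul_lt_mul_of_pos_right (hlt i) hrpos
  have heq : ∑ _i : Fin 3, b * r / (12 * (N + r)) * r = b * (4 * (N + r))⁻¹ * r ^ 2 := by
    rw [Fin.sum_univ_three]
    field_simp
    ring
  linarith

/-- Lattice points of a coordinate line at which `⟨·⟩ ^ α + ⟨· - c⟩ ^ α` lies in a fixed window
and has derivative at least `lam` in absolute value. -/
lemma card_line_le {α : ℝ} (hα : 1 ≤ α) (c : Fin 3 → ℤ) (ζ : ℝ) (i : Fin 3) {lam : ℝ}
    (hlam : 0 < lam) (S : Finset (Fin 3 → ℤ))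
    (hline : ∀ n ∈ S, ∀ m ∈ S, ∀ k, k ≠ i → m k = n k)
    (hwin : ∀ n ∈ S, |jb n ^ α + jb (n - c) ^ α - ζ| ≤ 2)
    (hgrad : ∀ n ∈ S, lam ≤ |pairGrad α c n i|) : (S.card : ℝ) ≤ 2 * (4 / lam + 1) := by
  have hinj : Set.InjOn (fun n : Fin 3 → ℤ => n i) S := by
    intro n hn m hm hnm
    funext k
    by_cases hk : k = i
    · rw [hk]; exact hnm
    · exact (hline n hn m hm k hk).symm
  have key : ∀ n ∈ S, ∀ m ∈ S, pairGrad α c n i * ((m i : ℝ) - n i) ≤ 4 := fun n hn m hm => by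
    have h1 := pair_tangent_le hα c i (hline n hn m hm)
    have h2 := abs_le.1 (hwin n hn)
    have h3 := abs_le.1 (hwin m hm)
    linarith
  have hsigned : ∀ T ⊆ S,
      ((∀ n ∈ T, lam ≤ pairGrad α c n i) ∨ (∀ n ∈ T, pairGrad α c n i ≤ -lam)) →
      (T.card : ℝ) ≤ 4 / lam + 1 := by
    intro T hTS hT
    rw [← Finset.card_image_of_injOn (hinj.mono (Finset.coe_subset.2 hTS))]
    refine card_le_of_sub_le _ _ (by positivity) ?_
    intro s hs t ht hst
    obtain ⟨n, hn, rfl⟩ := Finset.mem_image.1 hs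
    obtain ⟨m, hm, rfl⟩ := Finset.mem_image.1 ht
    have hst' : (0 : ℝ) < (m i : ℝ) - n i := sub_pos.2 (by exact_mod_cast hst)
    rw [le_div_iff₀ hlam]
    rcases hT with hT | hT
    · nlinarith [key n (hTS hn) m (hTS hm), mul_le_mul_of_nonneg_right (hT n hn) hst'.le]
    · nlinarith [key m (hTS hm) n (hTS hn), mul_le_mul_of_nonneg_right (hT m hm) hst'.le]
  rw [← Finset.card_filter_add_card_filter_not (fun n => 0 ≤ pairGrad α c n i)]
  have h1 := hsigned (S.filter fun n => 0 ≤ pairGrad α c n i) (Finset.filter_subset _ _)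
    (Or.inl fun n hn => by
      obtain ⟨hnS, h⟩ := Finset.mem_filter.1 hn
      simpa [abs_of_nonneg h] using hgrad n hnS)
  have h2 := hsigned (S.filter fun n => ¬ 0 ≤ pairGrad α c n i) (Finset.filter_subset _ _)
    (Or.inr fun n hn => by
      obtain ⟨hnS, h⟩ := Finset.mem_filter.1 hn
      have := hgrad n hnS
      rw [abs_of_neg (not_le.1 h)] at this
      linarith)
  push_cast
  linarith

open Classical in
/-- The lattice points of a cube at which `⟨·⟩ ^ α + ⟨· - c⟩ ^ α` lies in a fixed window. -/
def pairWindow (α : ℝ) (c : Fin 3 → ℤ) (ζ : ℝ) (N : ℕ) : Finset (Fin 3 → ℤ) :=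
  (latticeBox N).filter fun n => |jb n ^ α + jb (n - c) ^ α - ζ| ≤ 2

lemma mem_pairWindow {α : ℝ} {c : Fin 3 → ℤ} {ζ : ℝ} {N : ℕ} {n : Fin 3 → ℤ} :
    n ∈ pairWindow α c ζ N ↔ n ∈ latticeBox N ∧ |jb n ^ α + jb (n - c) ^ α - ζ| ≤ 2 := by
  simp [pairWindow]

/-- The points of `pairWindow` with a large `i`-th partial derivative on a line in direction `i`,
in terms of the distance from that line to the critical point. -/
lemma card_pairWindow_line_le {α : ℝ} (hα₁ : 1 < α) (c : Fin 3 → ℤ) (ζ : ℝ)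
    {N : ℕ} (hN : 1 ≤ N) (i : Fin 3) (p : Fin 3 → ℤ) (S : Finset (Fin 3 → ℤ))
    (hS : S ⊆ pairWindow α c ζ N) (hp : ∀ n ∈ S, Function.update n i 0 = p)
    (hgrad : ∀ n ∈ S,
      α * (α - 1) * ‖n + n - c‖ / (12 * (N + ‖n + n - c‖)) ≤ |pairGrad α c n i|) :
    (S.card : ℝ) ≤ (96 / (α * (α - 1)) + 3) *
      (1 + N * (max 1 ‖Function.update (p + p - c) i 0‖)⁻¹) := by
  have hline : ∀ n ∈ S, ∀ k, k ≠ i → n k = p k := fun n hn k hk => by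
    rw [← hp n hn, Function.update_of_ne hk]
  set r := ‖Function.update (p + p - c) i 0‖ with hr
  set b := α * (α - 1) with hb
  have hb0 : 0 < b := mul_pos (by linarith) (by linarith)
  have hN' : (1 : ℝ) ≤ N := by exact_mod_cast hN
  rcases le_total r 1 with hr1 | hr1
  · rw [max_eq_left hr1, inv_one, mul_one]
    have hinj : Set.InjOn (fun n : Fin 3 → ℤ => n i) S := by
      intro n hn m hm hnm
      funext k
      by_cases hk : k = i
      · rw [hk]; exact hnm
      · rw [hline n hn k hk, hline m hm k hk]
    have h1 : S.card ≤ (Finset.Icc (-(N : ℤ)) N).card := by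
      refine Finset.card_le_card_of_injOn (fun n => n i) ?_ hinj
      intro n hn
      exact Finset.mem_coe.2 (Finset.mem_Icc.2
        (abs_le.1 (mem_latticeBox.1 (mem_pairWindow.1 (hS hn)).1 i)))
    have h2 : (Finset.Icc (-(N : ℤ)) N).card = 2 * N + 1 := by
      rw [Int.card_Icc]; omega
    rw [h2] at h1
    have h3 : (S.card : ℝ) ≤ 2 * N + 1 := by exact_mod_cast h1
    have h4 : 0 ≤ 96 / b := by positivity
    nlinarith
  · rw [max_eq_right hr1]
    have hr0 : 0 < r := by linarith
    have hle : ∀ n ∈ S, r ≤ ‖n + n - c‖ := fun n hn => by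
      refine (pi_norm_le_iff_of_nonneg (norm_nonneg _)).2 fun k => ?_
      by_cases hk : k = i
      · rw [hk, Function.update_self, norm_zero]; exact norm_nonneg _
      · rw [Function.update_of_ne hk]
        have : (p + p - c) k = (n + n - c) k := by simp [hline n hn k hk]
        rw [this]
        exact norm_le_pi_norm _ k
    have hcard := card_line_le hα₁.le c ζ i (lam := b * r / (12 * (N + r))) (by positivity) S
      (fun n hn m hm k hk => by rw [hline n hn k hk, hline m hm k hk])
      (fun n hn => (mem_pairWindow.1 (hS hn)).2)
      (fun n hn => by
        refine le_trans ?_ (hgrad n hn)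
        have h1 := hle n hn
        rw [div_le_div_iff₀ (by positivity) (by positivity)]
        nlinarith [mul_le_mul_of_nonneg_left h1 (mul_pos hb0 (zero_lt_one.trans_le hN')).le])
    have h5 : 2 * (4 / (b * r / (12 * (N + r))) + 1) = 96 / b * (1 + N * r⁻¹) + 2 := by
      field_simp
      ring
    rw [h5] at hcard
    have h6 : 0 ≤ N * r⁻¹ := by positivity
    linarith

/-- The counting estimate for two brackets of equal sign. -/
lemma exists_card_pairWindow_le {α : ℝ} (hα₁ : 1 < α) (hα₂ : α ≤ 2) :
    ∃ K : ℝ, 0 < K ∧ ∀ (j : ℕ) (c : Fin 3 → ℤ) (ζ : ℝ),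
      ((pairWindow α c ζ (2 ^ j)).card : ℝ) ≤ K * (2 ^ j) ^ 2 := by
  classical
  set b := α * (α - 1) with hb
  have hb0 : 0 < b := mul_pos (by linarith) (by linarith)
  set L := 96 / b + 3 with hL
  have hL0 : 0 < L := by positivity
  refine ⟨3 * (54 * L), by positivity, fun j c ζ => ?_⟩
  have hN : 1 ≤ 2 ^ j := Nat.one_le_two_pow
  set W := pairWindow α c ζ (2 ^ j) with hW
  let S : Fin 3 → Finset (Fin 3 → ℤ) := fun i => W.filter fun n =>
    b * ‖n + n - c‖ / (12 * ((2 ^ j : ℕ) + ‖n + n - c‖)) ≤ |pairGrad α c n i|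
  have hcover : W ⊆ Finset.univ.biUnion S := by
    intro n hn
    obtain ⟨i, hi⟩ := exists_le_abs_pairGrad hα₁ hα₂ c hN (mem_pairWindow.1 hn).1
    exact Finset.mem_biUnion.2 ⟨i, Finset.mem_univ i, Finset.mem_filter.2 ⟨hn, hi⟩⟩
  have hSi : ∀ i, ((S i).card : ℝ) ≤ 54 * L * (2 ^ j) ^ 2 := by
    intro i
    set f : (Fin 3 → ℤ) → (Fin 3 → ℤ) := fun n => Function.update n i 0 with hf
    set T := (S i).image f with hT
    set ρ : (Fin 3 → ℤ) → ℝ := fun p => max 1 ‖Function.update (p + p - c) i 0‖ with hρ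
    have hT0 : ∀ p ∈ T, p i = 0 := by
      intro p hp
      obtain ⟨n, -, rfl⟩ := Finset.mem_image.1 hp
      simp [hf]
    have hTcard : (T.card : ℝ) ≤ 9 * (2 ^ j) ^ 2 := by
      have h := card_plane_le i 0 hN T 1 one_ne_zero hT0 (fun p hp k hk => by
        obtain ⟨n, hn, rfl⟩ := Finset.mem_image.1 hp
        have hn' := (mem_pairWindow.1 (Finset.mem_filter.1 hn).1).1
        simpa [hf, Function.update_of_ne hk] using mem_latticeBox.1 hn' k)
      push_cast at h
      exact h
    have hsum : ∑ p ∈ T, (ρ p)⁻¹ ≤ 5 * 9 * (2 ^ j) ^ 1 := by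
      refine sum_inv_le_of_card_le T ρ 9 1 j le_rfl (fun p _ => le_max_left _ _) ?_ hTcard
      intro l
      have h := card_plane_le i c (A := 2 ^ l) Nat.one_le_two_pow
        (T.filter fun p => ρ p ≤ 2 ^ l) 2 two_ne_zero
        (fun p hp => hT0 p (Finset.mem_filter.1 hp).1) (fun p hp k hk => by
          have h1 := (le_max_right _ _).trans (Finset.mem_filter.1 hp).2
          have h2 := (norm_le_pi_norm _ k).trans h1
          rw [Function.update_of_ne hk, Int.norm_eq_abs] at h2
          have h3 : |(p + p - c) k| ≤ ((2 ^ l : ℕ) : ℤ) := by exact_mod_cast h2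
          simpa [two_mul] using h3)
      push_cast at h
      exact h
    calc ((S i).card : ℝ)
        = ∑ p ∈ T, (((S i).filter fun n => f n = p).card : ℝ) := by
          rw [Finset.card_eq_sum_card_image f (S i)]
          push_cast
          rfl
      _ ≤ ∑ p ∈ T, L * (1 + (2 ^ j : ℕ) * (ρ p)⁻¹) := by
          refine Finset.sum_le_sum fun p _ => ?_
          refine card_pairWindow_line_le hα₁ c ζ hN i p _ ?_ ?_ ?_
          · exact (Finset.filter_subset _ _).trans (Finset.filter_subset _ _)
          · exact fun n hn => (Finset.mem_filter.1 hn).2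
          · exact fun n hn => (Finset.mem_filter.1 (Finset.mem_filter.1 hn).1).2
      _ = L * (T.card + 2 ^ j * ∑ p ∈ T, (ρ p)⁻¹) := by
          rw [← Finset.mul_sum, Finset.sum_add_distrib, ← Finset.mul_sum]
          simp
      _ ≤ L * (9 * (2 ^ j) ^ 2 + 2 ^ j * (5 * 9 * (2 ^ j) ^ 1)) := by gcongr
      _ = 54 * L * (2 ^ j) ^ 2 := by ring
  calc (W.card : ℝ) ≤ ((∑ i, (S i).card : ℕ) : ℝ) := by
        exact_mod_cast (Finset.card_le_card hcover).trans Finset.card_biUnion_le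
    _ = ∑ i, ((S i).card : ℝ) := by push_cast; rfl
    _ ≤ ∑ _i : Fin 3, 54 * L * (2 ^ j) ^ 2 := Finset.sum_le_sum fun i _ => hSi i
    _ = 3 * (54 * L) * (2 ^ j) ^ 2 := by rw [Fin.sum_univ_three]; ring

/-- The bracket `max 1 ‖m‖` attached to the sup norm. -/
def supBracket (m : Fin 3 → ℤ) : ℝ := max 1 ‖m‖

lemma one_le_supBracket (m : Fin 3 → ℤ) : 1 ≤ supBracket m := le_max_left _ _

lemma supBracket_pos (m : Fin 3 → ℤ) : 0 < supBracket m :=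
  zero_lt_one.trans_le (one_le_supBracket m)

lemma supBracket_neg (m : Fin 3 → ℤ) : supBracket (-m) = supBracket m := by
  rw [supBracket, norm_neg, supBracket]

lemma supBracket_le_jb (m : Fin 3 → ℤ) : supBracket m ≤ jb m := by
  refine max_le (one_le_jb m) ((pi_norm_le_iff_of_nonneg (jb_pos m).le).2 fun i => ?_)
  rw [Int.norm_eq_abs]
  exact abs_le_jb m i

lemma mem_latticeBox_of_supBracket_le {m : Fin 3 → ℤ} {i : ℕ} (h : supBracket m ≤ 2 ^ i) :
    m ∈ latticeBox (2 ^ i) := by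
  rw [mem_latticeBox_iff_norm_le]
  push_cast
  exact (le_max_right _ _).trans h

lemma ind_nonneg (p : Prop) : 0 ≤ ind p := by
  unfold ind
  split_ifs <;> norm_num

lemma ind_of_true {p : Prop} (h : p) : ind p = 1 := if_pos h

lemma ind_of_false {p : Prop} (h : ¬p) : ind p = 0 := if_neg h

lemma ind_mono {p q : Prop} (h : p → q) : ind p ≤ ind q := by
  by_cases hp : p
  · rw [ind_of_true hp, ind_of_true (h hp)]
  · rw [ind_of_false hp]
    exact ind_nonneg q

lemma sum_supBracket_inv_le (j : ℕ) (a : Fin 3 → ℤ) :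
    ∑ n ∈ latticeBox (2 ^ j), (supBracket (a + n))⁻¹ ≤ 5 * 27 * (2 ^ j) ^ 2 := by
  have hbox : ∀ i : ℕ, ((latticeBox (2 ^ i)).card : ℝ) ≤ 27 * (2 ^ i) ^ (2 + 1) := fun i => by
    have h := card_latticeBox_le (N := 2 ^ i) Nat.one_le_two_pow
    push_cast at h
    exact h
  refine sum_inv_le_of_card_le (latticeBox (2 ^ j)) (fun n => supBracket (a + n)) 27 2 j
    one_le_two (fun n _ => one_le_supBracket _) (fun i => ?_) (hbox j)
  refine le_trans (Nat.cast_le.2 ?_) (hbox i)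
  refine Finset.card_le_card_of_injOn (fun n => a + n) ?_ ((add_right_injective a).injOn)
  intro n hn
  exact mem_latticeBox_of_supBracket_le (Finset.mem_filter.1 hn).2

lemma sum_pairWindow_inv_le {α K : ℝ}
    (hK : ∀ (j : ℕ) (c : Fin 3 → ℤ) (ζ : ℝ),
      ((pairWindow α c ζ (2 ^ j)).card : ℝ) ≤ K * (2 ^ j) ^ 2)
    (j : ℕ) (c : Fin 3 → ℤ) (ζ : ℝ) :
    ∑ n ∈ pairWindow α c ζ (2 ^ j), (supBracket (n - c))⁻¹ ≤ 5 * K * 2 ^ j := by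
  have h := sum_inv_le_of_card_le (pairWindow α c ζ (2 ^ j)) (fun n => supBracket (n - c)) K 1 j
    le_rfl (fun n _ => one_le_supBracket _) (fun i => ?_) (hK j c ζ)
  · simpa using h
  refine le_trans (Nat.cast_le.2 ?_) (hK i (-c) ζ)
  refine Finset.card_le_card_of_injOn (fun n => n - c) ?_ (sub_left_injective.injOn)
  intro n hn
  obtain ⟨h1, h2⟩ := Finset.mem_filter.1 hn
  refine Finset.mem_coe.2 (mem_pairWindow.2 ⟨mem_latticeBox_of_supBracket_le h2, ?_⟩)
  simpa [add_comm] using (mem_pairWindow.1 h1).2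

lemma sum_pairWindow_inv_le_inv {α K : ℝ}
    (hK : ∀ (j : ℕ) (c : Fin 3 → ℤ) (ζ : ℝ),
      ((pairWindow α c ζ (2 ^ j)).card : ℝ) ≤ K * (2 ^ j) ^ 2)
    (j : ℕ) (c : Fin 3 → ℤ) (ζ : ℝ) :
    ∑ n ∈ pairWindow α c ζ (2 ^ j), (supBracket (n - c))⁻¹
      ≤ 10 * K * (2 ^ j) ^ 2 * (supBracket c)⁻¹ := by
  have hK0 : 0 ≤ K := by
    have := (Nat.cast_nonneg _).trans (hK 0 0 0)
    simpa using this
  have hc := supBracket_pos c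
  have h2j : (1 : ℝ) ≤ 2 ^ j := one_le_pow₀ one_le_two
  rcases le_or_gt (supBracket c) (2 * 2 ^ j) with h | h
  · refine (sum_pairWindow_inv_le hK j c ζ).trans ?_
    rw [← div_eq_mul_inv, le_div_iff₀ hc]
    have : 0 ≤ 5 * K * 2 ^ j := by positivity
    nlinarith [mul_le_mul_of_nonneg_left h this]
  · have hfar : ∀ n ∈ pairWindow α c ζ (2 ^ j), supBracket c / 2 ≤ supBracket (n - c) := by
      intro n hn
      have h1 : ‖n‖ ≤ 2 ^ j := by
        simpa using mem_latticeBox_iff_norm_le.1 (mem_pairWindow.1 hn).1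
      have h2 : supBracket c = ‖c‖ := by
        rw [supBracket, max_eq_right_iff]
        by_contra! h3
        rw [supBracket, max_eq_left h3.le] at h
        linarith
      have h4 : ‖c‖ ≤ ‖n‖ + ‖n - c‖ := by
        have := norm_sub_le n (n - c)
        rwa [sub_sub_cancel] at this
      have h5 : ‖n - c‖ ≤ supBracket (n - c) := le_max_right _ _
      linarith
    calc ∑ n ∈ pairWindow α c ζ (2 ^ j), (supBracket (n - c))⁻¹
        ≤ ∑ _n ∈ pairWindow α c ζ (2 ^ j), (supBracket c / 2)⁻¹ :=
          Finset.sum_le_sum fun n hn => inv_anti₀ (by positivity) (hfar n hn)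
      _ = (pairWindow α c ζ (2 ^ j)).card * (2 * (supBracket c)⁻¹) := by
          rw [Finset.sum_const, nsmul_eq_mul, inv_div, div_eq_mul_inv]
      _ ≤ K * (2 ^ j) ^ 2 * (2 * (supBracket c)⁻¹) := by
          gcongr
          exact hK j c ζ
      _ ≤ _ := by
          have : 0 ≤ K * (2 ^ j) ^ 2 * (supBracket c)⁻¹ := by positivity
          linarith

lemma sum_ind_mul_eq_sum_pairWindow {α : ℝ} {c : Fin 3 → ℤ} {ζ : ℝ} {N : ℕ}
    {P : (Fin 3 → ℤ) → Prop} (hP : ∀ n, P n ↔ |jb n ^ α + jb (n - c) ^ α - ζ| ≤ 2)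
    (f : (Fin 3 → ℤ) → ℝ) :
    ∑ n ∈ latticeBox N, ind (P n) * f n = ∑ n ∈ pairWindow α c ζ N, f n := by
  classical
  have h : pairWindow α c ζ N = (latticeBox N).filter P := by
    ext n
    rw [mem_pairWindow, Finset.mem_filter, hP]
  rw [h, Finset.sum_filter]
  refine Finset.sum_congr rfl fun n _ => ?_
  unfold ind
  split_ifs <;> simp

lemma IsSign.abs_eq {s : ℝ} (hs : IsSign s) (x z ζ : ℝ) :
    |s * x + z - ζ| = |x - s * (ζ - z)| := by
  rcases hs with rfl | rfl
  · congr 1; ring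
  · rw [← abs_neg]; congr 1; ring

/-- The sum in the main estimate without the weights of `n₂` and `n₃`. -/
def resonantSum (α s s₂ s₃ ζ : ℝ) (n₁ : Fin 3 → ℤ) (M₂ M₃ : ℕ) : ℝ :=
  ∑ n₂ ∈ latticeBox M₂, ∑ n₃ ∈ latticeBox M₃,
    ind (|s * jb (n₁ + n₂ + n₃) ^ α + s₂ * jb n₂ ^ α + s₃ * jb n₃ ^ α - ζ| ≤ 2) *
      (supBracket (n₁ + n₂ + n₃))⁻¹

lemma resonantSum_comm (α s s₂ s₃ ζ : ℝ) (n₁ : Fin 3 → ℤ) (M₂ M₃ : ℕ) :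
    resonantSum α s s₂ s₃ ζ n₁ M₂ M₃ = resonantSum α s s₃ s₂ ζ n₁ M₃ M₂ := by
  rw [resonantSum, Finset.sum_comm, resonantSum]
  refine Finset.sum_congr rfl fun n₃ _ => Finset.sum_congr rfl fun n₂ _ => ?_
  rw [add_right_comm n₁ n₂ n₃, add_right_comm _ (s₂ * _) (s₃ * _)]

lemma resonantSum_le_of_eq_left {α K : ℝ}
    (hK : ∀ (j : ℕ) (c : Fin 3 → ℤ) (ζ : ℝ),
      ((pairWindow α c ζ (2 ^ j)).card : ℝ) ≤ K * (2 ^ j) ^ 2)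
    {s s₃ : ℝ} (hs : IsSign s) (ζ : ℝ) (n₁ : Fin 3 → ℤ) {j k : ℕ} (hkj : k ≤ j) :
    resonantSum α s s s₃ ζ n₁ (2 ^ j) (2 ^ k) ≤ 135 * K * (2 ^ j) ^ 2 * (2 ^ k) ^ 2 := by
  have hK0 : 0 ≤ K := by
    have := (Nat.cast_nonneg _).trans (hK 0 0 0)
    simpa using this
  rw [resonantSum, Finset.sum_comm]
  have hinner : ∀ n₃ ∈ latticeBox (2 ^ k), ∑ n₂ ∈ latticeBox (2 ^ j),
      ind (|s * jb (n₁ + n₂ + n₃) ^ α + s * jb n₂ ^ α + s₃ * jb n₃ ^ α - ζ| ≤ 2) *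
        (supBracket (n₁ + n₂ + n₃))⁻¹ ≤ 5 * K * 2 ^ j := by
    intro n₃ _
    have hm : ∀ n₂ : Fin 3 → ℤ, n₁ + n₂ + n₃ = n₂ - (-(n₁ + n₃)) := fun n₂ => by abel
    rw [sum_ind_mul_eq_sum_pairWindow (α := α) (c := -(n₁ + n₃))
      (ζ := s * (ζ - s₃ * jb n₃ ^ α))]
    · simp only [hm]
      exact sum_pairWindow_inv_le hK j _ _
    · intro n₂
      rw [← hm, ← hs.abs_eq, mul_add, add_comm (s * jb n₂ ^ α)]
  have hcard := card_latticeBox_le (N := 2 ^ k) Nat.one_le_two_pow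
  push_cast at hcard
  have h2 : (2 : ℝ) ^ k ≤ 2 ^ j := pow_le_pow_right₀ one_le_two hkj
  calc _ ≤ ∑ _n₃ ∈ latticeBox (2 ^ k), 5 * K * 2 ^ j := Finset.sum_le_sum hinner
    _ = (latticeBox (2 ^ k)).card * (5 * K * 2 ^ j) := by rw [Finset.sum_const, nsmul_eq_mul]
    _ ≤ 27 * (2 ^ k) ^ 3 * (5 * K * 2 ^ j) := by gcongr
    _ = 135 * K * 2 ^ j * (2 ^ k) ^ 2 * 2 ^ k := by ring
    _ ≤ 135 * K * 2 ^ j * (2 ^ k) ^ 2 * 2 ^ j := by gcongr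
    _ = _ := by ring

lemma resonantSum_le_of_eq_right {α K : ℝ}
    (hK : ∀ (j : ℕ) (c : Fin 3 → ℤ) (ζ : ℝ),
      ((pairWindow α c ζ (2 ^ j)).card : ℝ) ≤ K * (2 ^ j) ^ 2)
    {s s₂ : ℝ} (hs : IsSign s) (ζ : ℝ) (n₁ : Fin 3 → ℤ) (j k : ℕ) :
    resonantSum α s s₂ s ζ n₁ (2 ^ j) (2 ^ k) ≤ 1350 * K * (2 ^ j) ^ 2 * (2 ^ k) ^ 2 := by
  have hK0 : 0 ≤ K := by
    have := (Nat.cast_nonneg _).trans (hK 0 0 0)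
    simpa using this
  rw [resonantSum]
  have hinner : ∀ n₂ ∈ latticeBox (2 ^ j), ∑ n₃ ∈ latticeBox (2 ^ k),
      ind (|s * jb (n₁ + n₂ + n₃) ^ α + s₂ * jb n₂ ^ α + s * jb n₃ ^ α - ζ| ≤ 2) *
        (supBracket (n₁ + n₂ + n₃))⁻¹
        ≤ 10 * K * (2 ^ k) ^ 2 * (supBracket (n₁ + n₂))⁻¹ := by
    intro n₂ _
    have hm : ∀ n₃ : Fin 3 → ℤ, n₁ + n₂ + n₃ = n₃ - (-(n₁ + n₂)) := fun n₃ => by abel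
    rw [sum_ind_mul_eq_sum_pairWindow (α := α) (c := -(n₁ + n₂))
      (ζ := s * (ζ - s₂ * jb n₂ ^ α)), ← supBracket_neg (n₁ + n₂)]
    · simp only [hm]
      exact sum_pairWindow_inv_le_inv hK k _ _
    · intro n₃
      rw [← hm, ← hs.abs_eq, mul_add, add_right_comm, add_comm (s * jb n₃ ^ α)]
  calc _ ≤ ∑ n₂ ∈ latticeBox (2 ^ j), 10 * K * (2 ^ k) ^ 2 * (supBracket (n₁ + n₂))⁻¹ :=
        Finset.sum_le_sum hinner
    _ = 10 * K * (2 ^ k) ^ 2 * ∑ n₂ ∈ latticeBox (2 ^ j), (supBracket (n₁ + n₂))⁻¹ := by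
        rw [Finset.mul_sum]
    _ ≤ 10 * K * (2 ^ k) ^ 2 * (5 * 27 * (2 ^ j) ^ 2) := by
        gcongr
        exact sum_supBracket_inv_le j n₁
    _ = _ := by ring

lemma resonantSum_le_of_eq_inner {α K : ℝ}
    (hK : ∀ (j : ℕ) (c : Fin 3 → ℤ) (ζ : ℝ),
      ((pairWindow α c ζ (2 ^ j)).card : ℝ) ≤ K * (2 ^ j) ^ 2)
    {s s₂ : ℝ} (hs₂ : IsSign s₂) (ζ : ℝ) (n₁ : Fin 3 → ℤ) {j k : ℕ} (hkj : k ≤ j) :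
    resonantSum α s s₂ s₂ ζ n₁ (2 ^ j) (2 ^ k) ≤ 540 * K * (2 ^ j) ^ 2 * (2 ^ k) ^ 2 := by
  have hK0 : 0 ≤ K := by
    have := (Nat.cast_nonneg _).trans (hK 0 0 0)
    simpa using this
  rw [resonantSum, Finset.sum_comm]
  set φ : (Fin 3 → ℤ) → (Fin 3 → ℤ) → ℝ := fun v n₃ =>
    ind (|s * jb (n₁ + v) ^ α + s₂ * jb (v - n₃) ^ α + s₂ * jb n₃ ^ α - ζ| ≤ 2) *
      (supBracket (n₁ + v))⁻¹ with hφ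
  have hshift : ∀ n₃ ∈ latticeBox (2 ^ k), ∑ n₂ ∈ latticeBox (2 ^ j),
      ind (|s * jb (n₁ + n₂ + n₃) ^ α + s₂ * jb n₂ ^ α + s₂ * jb n₃ ^ α - ζ| ≤ 2) *
        (supBracket (n₁ + n₂ + n₃))⁻¹ ≤ ∑ v ∈ latticeBox (2 ^ (j + 1)), φ v n₃ := by
    intro n₃ hn₃
    calc _ = ∑ n₂ ∈ latticeBox (2 ^ j), φ (n₂ + n₃) n₃ := by
          refine Finset.sum_congr rfl fun n₂ _ => ?_
          simp only [hφ, add_sub_cancel_right, add_assoc]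
      _ = ∑ v ∈ (latticeBox (2 ^ j)).map (addRightEmbedding n₃), φ v n₃ := by
          rw [Finset.sum_map]; rfl
      _ ≤ _ := by
          refine Finset.sum_le_sum_of_subset_of_nonneg ?_ fun v _ _ =>
            mul_nonneg (ind_nonneg _) (inv_nonneg.2 (supBracket_pos _).le)
          intro v hv
          obtain ⟨n₂, hn₂, rfl⟩ := Finset.mem_map.1 hv
          rw [mem_latticeBox_iff_norm_le] at hn₂ hn₃ ⊢
          push_cast at hn₂ hn₃ ⊢
          have h2 : (2 : ℝ) ^ k ≤ 2 ^ j := pow_le_pow_right₀ one_le_two hkj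
          have h3 := norm_add_le n₂ n₃
          rw [addRightEmbedding_apply, pow_succ]
          linarith
  have hcount : ∀ v ∈ latticeBox (2 ^ (j + 1)), ∑ n₃ ∈ latticeBox (2 ^ k), φ v n₃
      ≤ K * (2 ^ k) ^ 2 * (supBracket (n₁ + v))⁻¹ := by
    intro v _
    simp only [hφ]
    rw [sum_ind_mul_eq_sum_pairWindow (α := α) (c := v)
      (ζ := s₂ * (ζ - s * jb (n₁ + v) ^ α)) _ (fun _ => (supBracket (n₁ + v))⁻¹),
      Finset.sum_const, nsmul_eq_mul]
    · exact mul_le_mul_of_nonneg_right (hK k v _) (inv_nonneg.2 (supBracket_pos _).le)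
    · intro n₃
      rw [← hs₂.abs_eq, ← neg_sub v n₃, jb_neg]
      ring_nf
  calc _ ≤ ∑ n₃ ∈ latticeBox (2 ^ k), ∑ v ∈ latticeBox (2 ^ (j + 1)), φ v n₃ :=
        Finset.sum_le_sum hshift
    _ = ∑ v ∈ latticeBox (2 ^ (j + 1)), ∑ n₃ ∈ latticeBox (2 ^ k), φ v n₃ := Finset.sum_comm
    _ ≤ ∑ v ∈ latticeBox (2 ^ (j + 1)), K * (2 ^ k) ^ 2 * (supBracket (n₁ + v))⁻¹ :=
        Finset.sum_le_sum hcount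
    _ = K * (2 ^ k) ^ 2 * ∑ v ∈ latticeBox (2 ^ (j + 1)), (supBracket (n₁ + v))⁻¹ := by
        rw [Finset.mul_sum]
    _ ≤ K * (2 ^ k) ^ 2 * (5 * 27 * (2 ^ (j + 1)) ^ 2) := by
        gcongr
        exact sum_supBracket_inv_le (j + 1) n₁
    _ = _ := by ring

lemma IsSign.eq_or_eq_or_eq {s s₂ s₃ : ℝ} (hs : IsSign s) (hs₂ : IsSign s₂)
    (hs₃ : IsSign s₃) : s₂ = s ∨ s₃ = s ∨ s₃ = s₂ := by
  rcases hs with rfl | rfl <;> rcases hs₂ with rfl | rfl <;> rcases hs₃ with rfl | rfl <;> simp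

lemma exists_resonantSum_le {α : ℝ} (hα₁ : 1 < α) (hα₂ : α ≤ 2) :
    ∃ C : ℝ, 0 < C ∧ ∀ s s₂ s₃ : ℝ, IsSign s → IsSign s₂ → IsSign s₃ →
      ∀ (ζ : ℝ) (n₁ : Fin 3 → ℤ) (j k : ℕ),
        resonantSum α s s₂ s₃ ζ n₁ (2 ^ j) (2 ^ k) ≤ C * (2 ^ j) ^ 2 * (2 ^ k) ^ 2 := by
  obtain ⟨K, hK0, hK⟩ := exists_card_pairWindow_le hα₁ hα₂
  refine ⟨1350 * K, by positivity, fun s s₂ s₃ hs hs₂ hs₃ ζ n₁ j k => ?_⟩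
  wlog hkj : k ≤ j generalizing s₂ s₃ j k with H
  · rw [resonantSum_comm]
    refine (H s₃ s₂ hs₃ hs₂ k j (le_of_not_ge hkj)).trans (le_of_eq ?_)
    ring
  have hpos : 0 ≤ K * (2 ^ j) ^ 2 * (2 ^ k) ^ 2 := by positivity
  rcases hs.eq_or_eq_or_eq hs₂ hs₃ with rfl | rfl | rfl
  · exact (resonantSum_le_of_eq_left hK hs₂ ζ n₁ hkj).trans (by linarith)
  · exact resonantSum_le_of_eq_right hK hs₃ ζ n₁ j k
  · exact (resonantSum_le_of_eq_inner hK hs₃ ζ n₁ hkj).trans (by linarith)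

lemma half_jb_rpow_le_jbb {α : ℝ} (hα : 0 ≤ α) (n : Fin 3 → ℤ) : jb n ^ α / 2 ≤ jbb α n := by
  have h1 : 1 ≤ jb n ^ α := Real.one_le_rpow (one_le_jb n) hα
  refine Real.le_sqrt_of_sq_le ?_
  rw [two_mul, Real.rpow_add (jb_pos n)]
  nlinarith

lemma abs_jbb_sub_le {α : ℝ} (hα : 0 ≤ α) (n : Fin 3 → ℤ) : |jbb α n - jb n ^ α| ≤ 1 / 4 := by
  have h1 : 1 ≤ jb n ^ α := Real.one_le_rpow (one_le_jb n) hα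
  have h2 : jb n ^ (2 * α) = jb n ^ α * jb n ^ α := by
    rw [two_mul, Real.rpow_add (jb_pos n)]
  rw [jbb, h2, abs_le]
  constructor
  · have : jb n ^ α - 1 / 4 ≤ √(jb n ^ α * jb n ^ α - 1 / 4) :=
      Real.le_sqrt_of_sq_le (by nlinarith)
    linarith
  · have : √(jb n ^ α * jb n ^ α - 1 / 4) ≤ jb n ^ α + 1 / 4 :=
      Real.sqrt_le_iff.2 ⟨by linarith, by nlinarith⟩
    linarith

lemma jbb_inv_le {α : ℝ} (hα : 1 ≤ α) (n : Fin 3 → ℤ) :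
    (jbb α n)⁻¹ ≤ 2 * (supBracket n)⁻¹ := by
  have h1 : supBracket n ≤ jb n ^ α :=
    (supBracket_le_jb n).trans (Real.self_le_rpow_of_one_le (one_le_jb n) hα)
  have h2 := half_jb_rpow_le_jbb (zero_le_one.trans hα) n
  have h3 := supBracket_pos n
  calc (jbb α n)⁻¹ ≤ (supBracket n / 2)⁻¹ := inv_anti₀ (by positivity) (by linarith)
    _ = 2 * (supBracket n)⁻¹ := by rw [inv_div, div_eq_mul_inv]

lemma znorm_le_jb (n : Fin 3 → ℤ) : znorm n ≤ jb n :=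
  Real.sqrt_le_sqrt (by linarith)

lemma abs_le_znorm (n : Fin 3 → ℤ) (i : Fin 3) : |(n i : ℝ)| ≤ znorm n := by
  rw [← Real.sqrt_sq_eq_abs]
  exact Real.sqrt_le_sqrt (Finset.single_le_sum (f := fun i => (n i : ℝ) ^ 2)
    (fun i _ => sq_nonneg _) (Finset.mem_univ i))

lemma SimFreq.mem_latticeBox {j : ℕ} {n : Fin 3 → ℤ} (h : SimFreq (2 ^ j) n) :
    n ∈ latticeBox (2 ^ j) := by
  have hz : znorm n ≤ 2 ^ j := by
    rcases h with h | h
    · exact h.2.2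
    · exact h.2.trans (one_le_pow₀ one_le_two)
  rw [_root_.mem_latticeBox]
  intro i
  have := (abs_le_znorm n i).trans hz
  exact_mod_cast this

lemma SimFreq.half_le_jb {N : ℝ} {n : Fin 3 → ℤ} (h : SimFreq N n) : N / 2 ≤ jb n := by
  rcases h with h | h
  · exact h.2.1.le.trans (znorm_le_jb n)
  · linarith [one_le_jb n]

lemma SimFreq.jbb_rpow_le {α N : ℝ} (hα₁ : 1 ≤ α) (hα₂ : α ≤ 2) (hN : 0 < N)
    {n : Fin 3 → ℤ} (h : SimFreq N n) : jbb α n ^ (-2 : ℝ) ≤ 64 * N ^ (-2 * α) := by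
  have h1 : N ^ α / 8 ≤ jbb α n := by
    have h2 : N ^ α / 4 ≤ (N / 2) ^ α := by
      rw [Real.div_rpow hN.le zero_le_two]
      have h4 : (2 : ℝ) ^ α ≤ 4 := by
        calc (2 : ℝ) ^ α ≤ 2 ^ (2 : ℝ) := Real.rpow_le_rpow_of_exponent_le one_le_two hα₂
          _ = 4 := by norm_num
      gcongr
    have h3 : (N / 2) ^ α ≤ jb n ^ α :=
      Real.rpow_le_rpow (by positivity) h.half_le_jb (by linarith)
    linarith [half_jb_rpow_le_jbb (zero_le_one.trans hα₁) n]
  calc jbb α n ^ (-2 : ℝ) ≤ (N ^ α / 8) ^ (-2 : ℝ) :=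
        Real.rpow_le_rpow_of_nonpos (by positivity) h1 (by norm_num)
    _ = 64 * N ^ (-2 * α) := by
        rw [Real.div_rpow (by positivity) (by norm_num), ← Real.rpow_mul hN.le, mul_comm α,
          Real.rpow_neg (by norm_num : (0 : ℝ) ≤ 8)]
        norm_num
        ring

/-- **Double-resonance quintic counting estimate** (Lemma 3.9): for `1 < α ≤ 2` and
`ε > 0` arbitrarily small there is `C = C(α,ε) > 0`, uniform in the choice of signs,
such that for all dyadic `N₁, N₂, N₃ ≥ 1`, every `ζ ∈ ℝ` and every `n₁ ∈ ℤ³` with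
`|n₁| ∼ N₁`,
`Σ_{n₂,n₃} 1_{|n₂|∼N₂} 1_{|n₃|∼N₃} ⟪n₁+n₂+n₃⟫⁻¹ ⟪n₂⟫⁻² ⟪n₃⟫⁻² 1_{|κ₂−ζ|≤1}
  ≤ C · N₂^{2−2α+ε} · N₃^{2−2α+ε}`. -/
theorem double_resonance_counting (α : ℝ) (hα₁ : 1 < α) (hα₂ : α ≤ 2)
    (ε : ℝ) (hε : 0 < ε) :
    ∃ C : ℝ, 0 < C ∧
      ∀ ε123 ε1 ε2 ε3 : ℝ, IsSign ε123 → IsSign ε1 → IsSign ε2 → IsSign ε3 →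
        ∀ N₁ N₂ N₃ : ℝ, IsDyadic N₁ → IsDyadic N₂ → IsDyadic N₃ → ∀ ζ : ℝ,
          ∀ n₁ : Fin 3 → ℤ, SimFreq N₁ n₁ →
            (∑' p : (Fin 3 → ℤ) × (Fin 3 → ℤ),
                ind (SimFreq N₂ p.1) * ind (SimFreq N₃ p.2) *
                  (jbb α (n₁ + p.1 + p.2))⁻¹ *
                  jbb α p.1 ^ (-2 : ℝ) * jbb α p.2 ^ (-2 : ℝ) *
                  ind (|ε123 * jbb α (n₁ + p.1 + p.2) + ε1 * jbb α n₁ +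
                        ε2 * jbb α p.1 + ε3 * jbb α p.2 - ζ| ≤ 1))
              ≤ C * N₂ ^ (2 - 2 * α + ε) * N₃ ^ (2 - 2 * α + ε) := by
  obtain ⟨C, hC, hsum⟩ := exists_resonantSum_le hα₁ hα₂
  refine ⟨8192 * C, by positivity, ?_⟩
  rintro s s₁ s₂ s₃ hs - hs₂ hs₃ _ _ _ - ⟨j, rfl⟩ ⟨k, rfl⟩ ζ n₁ -
  have hα0 : 0 ≤ α := by linarith
  have hterm : ∀ n₂ n₃ : Fin 3 → ℤ,
      ind (SimFreq (2 ^ j) n₂) * ind (SimFreq (2 ^ k) n₃) * (jbb α (n₁ + n₂ + n₃))⁻¹ *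
          jbb α n₂ ^ (-2 : ℝ) * jbb α n₃ ^ (-2 : ℝ) *
          ind (|s * jbb α (n₁ + n₂ + n₃) + s₁ * jbb α n₁ + s₂ * jbb α n₂ + s₃ * jbb α n₃ - ζ| ≤ 1)
        ≤ 8192 * (2 ^ j) ^ (-2 * α) * (2 ^ k) ^ (-2 * α) *
          (ind (|s * jb (n₁ + n₂ + n₃) ^ α + s₂ * jb n₂ ^ α + s₃ * jb n₃ ^ α -
            (ζ - s₁ * jbb α n₁)| ≤ 2) * (supBracket (n₁ + n₂ + n₃))⁻¹) := by
    intro n₂ n₃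
    have hrhs : 0 ≤ 8192 * ((2 : ℝ) ^ j) ^ (-2 * α) * (2 ^ k) ^ (-2 * α) *
          (ind (|s * jb (n₁ + n₂ + n₃) ^ α + s₂ * jb n₂ ^ α + s₃ * jb n₃ ^ α -
            (ζ - s₁ * jbb α n₁)| ≤ 2) * (supBracket (n₁ + n₂ + n₃))⁻¹) :=
      mul_nonneg (by positivity) (mul_nonneg (ind_nonneg _) (inv_nonneg.2 (supBracket_pos _).le))
    by_cases h₂ : SimFreq (2 ^ j) n₂
    swap
    · rw [ind_of_false h₂]; simpa using hrhs
    by_cases h₃ : SimFreq (2 ^ k) n₃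
    swap
    · rw [ind_of_false h₃]; simpa using hrhs
    rw [ind_of_true h₂, ind_of_true h₃, one_mul, one_mul]
    have hwin : ind (|s * jbb α (n₁ + n₂ + n₃) + s₁ * jbb α n₁ + s₂ * jbb α n₂ +
          s₃ * jbb α n₃ - ζ| ≤ 1)
        ≤ ind (|s * jb (n₁ + n₂ + n₃) ^ α + s₂ * jb n₂ ^ α + s₃ * jb n₃ ^ α -
            (ζ - s₁ * jbb α n₁)| ≤ 2) := by
      refine ind_mono fun h => ?_
      have hsign : ∀ {t : ℝ} (m : Fin 3 → ℤ), IsSign t →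
          |t * jbb α m - t * jb m ^ α| ≤ 1 / 4 := fun {t} m ht => by
        have := abs_jbb_sub_le hα0 m
        rw [← mul_sub, abs_mul]
        rcases ht with rfl | rfl <;> simpa using this
      have e₁ := abs_le.1 (hsign (n₁ + n₂ + n₃) hs)
      have e₂ := abs_le.1 (hsign n₂ hs₂)
      have e₃ := abs_le.1 (hsign n₃ hs₃)
      have e := abs_le.1 h
      exact abs_le.2 ⟨by linarith, by linarith⟩
    have hb := jbb_inv_le hα₁.le (n₁ + n₂ + n₃)
    have hb₂ := h₂.jbb_rpow_le hα₁.le hα₂ (by positivity)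
    have hb₃ := h₃.jbb_rpow_le hα₁.le hα₂ (by positivity)
    have p₂ : 0 ≤ jbb α n₂ ^ (-2 : ℝ) := Real.rpow_nonneg (Real.sqrt_nonneg _) _
    have p₃ : 0 ≤ jbb α n₃ ^ (-2 : ℝ) := Real.rpow_nonneg (Real.sqrt_nonneg _) _
    have p₄ := (supBracket_pos (n₁ + n₂ + n₃)).le
    calc _ ≤ 2 * (supBracket (n₁ + n₂ + n₃))⁻¹ * (64 * (2 ^ j) ^ (-2 * α)) *
            (64 * (2 ^ k) ^ (-2 * α)) *
            ind (|s * jb (n₁ + n₂ + n₃) ^ α + s₂ * jb n₂ ^ α + s₃ * jb n₃ ^ α -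
              (ζ - s₁ * jbb α n₁)| ≤ 2) := by
          refine mul_le_mul ?_ hwin (ind_nonneg _) (by positivity)
          refine mul_le_mul ?_ hb₃ p₃ (by positivity)
          exact mul_le_mul hb hb₂ p₂ (by positivity)
      _ = _ := by ring
  have hpow : ∀ l : ℕ, ((2 : ℝ) ^ l) ^ (-2 * α) * (2 ^ l) ^ 2 ≤ (2 ^ l) ^ (2 - 2 * α + ε) := by
    intro l
    have h1 : (1 : ℝ) ≤ 2 ^ l := one_le_pow₀ one_le_two
    rw [← Real.rpow_natCast ((2 : ℝ) ^ l) 2, ← Real.rpow_add (by positivity)]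
    refine Real.rpow_le_rpow_of_exponent_le h1 ?_
    push_cast
    linarith
  rw [tsum_eq_sum (s := latticeBox (2 ^ j) ×ˢ latticeBox (2 ^ k))]
  · rw [Finset.sum_product]
    calc _ ≤ ∑ n₂ ∈ latticeBox (2 ^ j), ∑ n₃ ∈ latticeBox (2 ^ k),
            8192 * (2 ^ j) ^ (-2 * α) * (2 ^ k) ^ (-2 * α) *
            (ind (|s * jb (n₁ + n₂ + n₃) ^ α + s₂ * jb n₂ ^ α + s₃ * jb n₃ ^ α -
              (ζ - s₁ * jbb α n₁)| ≤ 2) * (supBracket (n₁ + n₂ + n₃))⁻¹) :=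
          Finset.sum_le_sum fun n₂ _ => Finset.sum_le_sum fun n₃ _ => hterm n₂ n₃
      _ = 8192 * (2 ^ j) ^ (-2 * α) * (2 ^ k) ^ (-2 * α) *
            resonantSum α s s₂ s₃ (ζ - s₁ * jbb α n₁) n₁ (2 ^ j) (2 ^ k) := by
          simp only [resonantSum, Finset.mul_sum]
      _ ≤ 8192 * (2 ^ j) ^ (-2 * α) * (2 ^ k) ^ (-2 * α) * (C * (2 ^ j) ^ 2 * (2 ^ k) ^ 2) := by
          gcongr
          exact hsum s s₂ s₃ hs hs₂ hs₃ _ n₁ j k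
      _ = 8192 * C * ((2 ^ j) ^ (-2 * α) * (2 ^ j) ^ 2) *
            ((2 ^ k) ^ (-2 * α) * (2 ^ k) ^ 2) := by ring
      _ ≤ _ := by
          gcongr
          · exact hpow j
          · exact hpow k
  · intro p hp
    rw [Finset.mem_product, not_and_or] at hp
    rcases hp with hp | hp
    · rw [ind_of_false fun h => hp h.mem_latticeBox]; simp
    · rw [ind_of_false (p := SimFreq _ p.2) fun h => hp h.mem_latticeBox]; simp
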